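/- arXiv:1511.02047 — 7 statements merged into one kernel-verified Lean document; each statement's English description precedes it below -/
import Mathlib

section
/- Let h > 0 and let k be a complex number with k ≠ 0 and sinh(k·h) ≠ 0. Let w : [0,h] → ℂ be twice continuously differentiable and f : [0,h] → ℂ continuous, and suppose that w''(y) − k²·w(y) = f(y) for all y ∈ [0,h] and that w'(0) = w'(h) = 0. Then w(0) = −∫₀ʰ f(y)·cosh(k(h−y))/(k·sinh(k·h)) dy. -/
open Set

/-- Green's-function representation for the Neumann problem
`w'' − k²·w = f` on `[0,h]` with `w'(0) = w'(h) = 0`. -/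
theorem green_function_neumann
    (h : ℝ) (hh : 0 < h) (k : ℂ) (hk : k ≠ 0)
    (hsinh : Complex.sinh (k * h) ≠ 0)
    (w w' w'' f : ℝ → ℂ)
    (hw : ∀ y ∈ Icc (0:ℝ) h, HasDerivWithinAt w (w' y) (Icc 0 h) y)
    (hw' : ∀ y ∈ Icc (0:ℝ) h, HasDerivWithinAt w' (w'' y) (Icc 0 h) y)
    (hw''cont : ContinuousOn w'' (Icc 0 h))
    (hfcont : ContinuousOn f (Icc 0 h))
    (hode : ∀ y ∈ Icc (0:ℝ) h, w'' y - k ^ 2 * w y = f y)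
    (hb0 : w' 0 = 0) (hbh : w' h = 0) :
    w 0 = -∫ y in (0:ℝ)..h,
      f y * Complex.cosh (k * ((h : ℂ) - y)) / (k * Complex.sinh (k * h)) := by
  have hlin : ∀ y : ℝ, HasDerivAt (fun y : ℝ => k * ((h : ℂ) - (y : ℂ))) (-k) y := by
    intro y
    have h1 : HasDerivAt (fun y : ℝ => (y : ℂ)) 1 y := Complex.ofRealCLM.hasDerivAt
    have h2 := (h1.const_sub (h : ℂ)).const_mul k
    exact h2.congr_deriv (by ring)
  have hF : ∀ y ∈ Icc (0:ℝ) h, HasDerivWithinAt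
      (fun y : ℝ => (w' y * Complex.cosh (k * ((h : ℂ) - y)) +
        k * w y * Complex.sinh (k * ((h : ℂ) - y))) / (k * Complex.sinh (k * h)))
      (f y * Complex.cosh (k * ((h : ℂ) - y)) / (k * Complex.sinh (k * h))) (Icc 0 h) y := by
    intro y hy
    have hc : HasDerivAt (fun y : ℝ => Complex.cosh (k * ((h : ℂ) - y)))
        (Complex.sinh (k * ((h : ℂ) - y)) * (-k)) y :=
      (Complex.hasDerivAt_cosh _).comp y (hlin y)
    have hs : HasDerivAt (fun y : ℝ => Complex.sinh (k * ((h : ℂ) - y)))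
        (Complex.cosh (k * ((h : ℂ) - y)) * (-k)) y :=
      (Complex.hasDerivAt_sinh _).comp y (hlin y)
    have hd := (((hw' y hy).mul hc.hasDerivWithinAt).add
      (((hw y hy).const_mul k).mul hs.hasDerivWithinAt)).div_const (k * Complex.sinh (k * h))
    refine hd.congr_deriv ?_
    rw [← hode y hy]
    ring
  have hcontI : ContinuousOn (fun y : ℝ =>
      f y * Complex.cosh (k * ((h : ℂ) - y)) / (k * Complex.sinh (k * h))) (Icc 0 h) := by
    refine (hfcont.mul (Continuous.continuousOn ?_)).div_const _
    exact Complex.continuous_cosh.comp (by fun_prop)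
  have key := intervalIntegral.integral_eq_sub_of_hasDerivAt_of_le hh.le
    (fun y hy => (hF y hy).continuousWithinAt)
    (fun y hy => (hF y (Ioo_subset_Icc_self hy)).hasDerivAt (Icc_mem_nhds hy.1 hy.2))
    (hcontI.intervalIntegrable_of_Icc hh.le)
  rw [key]
  simp only [hb0, hbh, sub_self, mul_zero, Complex.sinh_zero, zero_mul, add_zero, zero_div,
    Complex.ofReal_zero, sub_zero, zero_add, zero_sub, neg_neg]
  field_simp
end

section
/- Let h > 0 and k > 0 be real numbers. Then for every y ∈ [0,h] one has the identity cosh(k(h−y))/(k·sinh(k·h)) − e^{−ky}/k = e^{−kh}·cosh(k·y)/(k·sinh(k·h)); in particular 0 < cosh(k(h−y))/(k·sinh(k·h)) − e^{−ky}/k ≤ coth(k·h)·e^{−kh}/k for all y ∈ [0,h]. -/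
/-- Approximation of the Neumann kernel `ρ_k(y) = cosh(k(h−y))/(k·sinh(kh))`
by the exponential profile `e^{−ky}/k` (estimate (rhoest1) of the paper, real `k`). -/
theorem kernel_exponential_approx (h k : ℝ) (hh : 0 < h) (hk : 0 < k) :
    ∀ y ∈ Set.Icc (0:ℝ) h,
      (Real.cosh (k * (h - y)) / (k * Real.sinh (k * h)) - Real.exp (-k * y) / k
        = Real.exp (-k * h) * Real.cosh (k * y) / (k * Real.sinh (k * h))) ∧
      (0 < Real.cosh (k * (h - y)) / (k * Real.sinh (k * h)) - Real.exp (-k * y) / k) ∧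
      (Real.cosh (k * (h - y)) / (k * Real.sinh (k * h)) - Real.exp (-k * y) / k
        ≤ (Real.cosh (k * h) / Real.sinh (k * h)) * Real.exp (-k * h) / k) := by
  intro y hy
  have hs : 0 < Real.sinh (k * h) := Real.sinh_pos_iff.2 (mul_pos hk hh)
  have key : Real.cosh (k * (h - y)) / (k * Real.sinh (k * h)) - Real.exp (-k * y) / k
      = Real.exp (-k * h) * Real.cosh (k * y) / (k * Real.sinh (k * h)) := by
    have e1 : Real.exp (-k * y) = Real.cosh (k * y) - Real.sinh (k * y) := by
      rw [Real.cosh_sub_sinh, neg_mul]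
    have e2 : Real.exp (-k * h) = Real.cosh (k * h) - Real.sinh (k * h) := by
      rw [Real.cosh_sub_sinh, neg_mul]
    rw [e1, e2, mul_sub, Real.cosh_sub]
    field_simp
    ring
  refine ⟨key, ?_, ?_⟩
  · rw [key]
    have := Real.cosh_pos (k * y)
    positivity
  · rw [key]
    have hc : Real.cosh (k * y) ≤ Real.cosh (k * h) := by
      rw [Real.cosh_le_cosh, abs_of_nonneg (mul_nonneg hk.le hy.1),
        abs_of_pos (mul_pos hk hh)]
      exact mul_le_mul_of_nonneg_left hy.2 hk.le
    have e : (Real.cosh (k * h) / Real.sinh (k * h)) * Real.exp (-k * h) / k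
        = Real.exp (-k * h) * Real.cosh (k * h) / (k * Real.sinh (k * h)) := by
      field_simp
    rw [e]
    gcongr
end

section
/- Let h > 0 be real and let k, m, λ, ν, β be complex numbers with ν ≠ 0, λ ≠ 0, m² = k² + λ/ν, sinh(k·h) ≠ 0 and sinh(m·h) ≠ 0. Define ω(y) = β·sinh(m(h−y))/sinh(m·h) and ψ(y) = −(ν·β/λ)·[sinh(k·h)·sinh(m(h−y)) − sinh(m·h)·sinh(k(h−y))]/(sinh(m·h)·sinh(k·h)) for y ∈ [0,h]. Then ω''(y) − m²·ω(y) = 0 with ω(h) = 0 and ω(0) = β, and ψ''(y) − k²·ψ(y) = −ω(y) with ψ(0) = ψ(h) = 0. -/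
theorem aux_sinh (h : ℝ) (m : ℂ) (y : ℝ) :
    HasDerivAt (fun y : ℝ => Complex.sinh (m * ((h : ℂ) - y)))
      (-m * Complex.cosh (m * ((h : ℂ) - y))) y := by
  have h1 : HasDerivAt (fun y : ℝ => m * ((h : ℂ) - y)) (m * (-1)) y :=
    ((Complex.ofRealCLM.hasDerivAt (x := y)).const_sub (h : ℂ)).const_mul m
  have h2 := (Complex.hasDerivAt_sinh (m * ((h : ℂ) - y))).comp y h1
  exact h2.congr_deriv (by ring)

theorem aux_cosh (h : ℝ) (m : ℂ) (y : ℝ) :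
    HasDerivAt (fun y : ℝ => Complex.cosh (m * ((h : ℂ) - y)))
      (-m * Complex.sinh (m * ((h : ℂ) - y))) y := by
  have h1 : HasDerivAt (fun y : ℝ => m * ((h : ℂ) - y)) (m * (-1)) y :=
    ((Complex.ofRealCLM.hasDerivAt (x := y)).const_sub (h : ℂ)).const_mul m
  have h2 := (Complex.hasDerivAt_cosh (m * ((h : ℂ) - y))).comp y h1
  exact h2.congr_deriv (by ring)

theorem aux_dd (h : ℝ) (m k A B : ℂ) (f : ℝ → ℂ)
    (hf : ∀ y : ℝ, f y = A * Complex.sinh (m * ((h : ℂ) - y))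
      + B * Complex.sinh (k * ((h : ℂ) - y))) (y : ℝ) :
    deriv (deriv f) y = A * m ^ 2 * Complex.sinh (m * ((h : ℂ) - y))
      + B * k ^ 2 * Complex.sinh (k * ((h : ℂ) - y)) := by
  obtain rfl := funext hf
  have h1 : deriv (fun y : ℝ => A * Complex.sinh (m * ((h : ℂ) - y))
      + B * Complex.sinh (k * ((h : ℂ) - y))) =
      fun y : ℝ => A * (-m * Complex.cosh (m * ((h : ℂ) - y)))
      + B * (-k * Complex.cosh (k * ((h : ℂ) - y))) := by
    funext z
    exact (((aux_sinh h m z).const_mul A).add ((aux_sinh h k z).const_mul B)).deriv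
  rw [h1]
  have h2 := ((((aux_cosh h m y).const_mul (-m)).const_mul A).add
    (((aux_cosh h k y).const_mul (-k)).const_mul B)).deriv
  refine Eq.trans h2 ?_
  ring


/-- Explicit solution formulas (omFk), (psiF2), (psiF2a) of the paper:
`ω` solves `ω'' − m²ω = 0` with `ω(h)=0`, `ω(0)=β`, and `ψ` solves
`ψ'' − k²ψ = −ω` with zero Dirichlet data, where `m² = k² + λ/ν`. -/
theorem vorticity_stream_explicit (h : ℝ) (hh : 0 < h) (k m lam ν β : ℂ)
    (hν : ν ≠ 0) (hlam : lam ≠ 0) (hm : m ^ 2 = k ^ 2 + lam / ν)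
    (hsk : Complex.sinh (k * h) ≠ 0) (hsm : Complex.sinh (m * h) ≠ 0) :
    let ω : ℝ → ℂ := fun y => β * Complex.sinh (m * ((h : ℂ) - y)) / Complex.sinh (m * h)
    let ψ : ℝ → ℂ := fun y => -(ν * β / lam) *
      (Complex.sinh (k * h) * Complex.sinh (m * ((h : ℂ) - y)) -
        Complex.sinh (m * h) * Complex.sinh (k * ((h : ℂ) - y))) /
      (Complex.sinh (m * h) * Complex.sinh (k * h))
    (∀ y ∈ Set.Icc (0:ℝ) h, deriv (deriv ω) y - m ^ 2 * ω y = 0) ∧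
    ω h = 0 ∧ ω 0 = β ∧
    (∀ y ∈ Set.Icc (0:ℝ) h, deriv (deriv ψ) y - k ^ 2 * ψ y = -ω y) ∧
    ψ 0 = 0 ∧ ψ h = 0 := by
  intro ω ψ
  refine ⟨?_, ?_, ?_, ?_, ?_, ?_⟩
  · intro y _
    rw [aux_dd h m k (β / Complex.sinh (m * h)) 0 ω (fun y => by simp only [ω]; ring) y]
    simp only [ω]
    ring
  · simp [ω]
  · simp [ω, hsm]
  · intro y _
    rw [aux_dd h m k (-(ν * β / lam) / Complex.sinh (m * h))
      ((ν * β / lam) / Complex.sinh (k * h)) ψ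
      (fun y => by 
        simp only [ψ]
        generalize Complex.sinh (m * (h : ℂ)) = a at hsm ⊢
        generalize Complex.sinh (k * (h : ℂ)) = b at hsk ⊢
        generalize Complex.sinh (m * ((h : ℂ) - y)) = c
        generalize Complex.sinh (k * ((h : ℂ) - y)) = d
        field_simp
        ring) y]
    simp only [ω, ψ]
    rw [hm]
    clear_value ω ψ
    generalize Complex.sinh (m * (h : ℂ)) = a at hsm ⊢
    generalize Complex.sinh (k * (h : ℂ)) = b at hsk ⊢
    generalize Complex.sinh (m * ((h : ℂ) - y)) = c
    generalize Complex.sinh (k * ((h : ℂ) - y)) = d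
    field_simp
    ring
  · simp [ψ, mul_comm]
  · simp [ψ]
end

section
/- Let κ > 0 and set z₀ = 5κ. Let δ : ℝ → ℝ be a nonnegative integrable function with δ(t) = 0 for |t| ≥ κ and ∫_ℝ δ(t) dt = 1. For a complex number p with Re p > 0 define g(p) = −1 + ∫₀^∞ δ(y − z₀)·e^{−p·y} dy. Then Re g(p) ≤ −min{ 4·e^{−4}·κ·Re p , 1/2 }. -/
open MeasureTheory

/-- Lemma 6.3 of the paper: decay of the real part of
`g_κ(p) = −1 + ∫₀^∞ δ(y − z₀)·e^{−py} dy`, where `δ` is a mollifier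
supported in `(−κ, κ)` and `z₀ = 5κ`. -/
theorem g_re_decay (κ : ℝ) (hκ : 0 < κ) (δ : ℝ → ℝ)
    (hδnonneg : ∀ t, 0 ≤ δ t) (hδint : Integrable δ)
    (hδsupp : ∀ t, κ ≤ |t| → δ t = 0)
    (hδnorm : (∫ t, δ t) = 1)
    (p : ℂ) (hp : 0 < p.re) :
    ((-1 : ℂ) + ∫ y in Set.Ioi (0:ℝ),
        (δ (y - 5 * κ) : ℂ) * Complex.exp (-(p * y))).re
      ≤ -min (4 * Real.exp (-4) * κ * p.re) (1 / 2) := by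
  set s : ℝ := 4 * κ * p.re with hs
  have hs0 : 0 < s := by positivity
  have hI : Integrable (fun y : ℝ => δ (y - 5 * κ) * Real.exp (-s)) :=
    (hδint.comp_sub_right (5 * κ)).mul_const _
  have h1 : ‖∫ y in Set.Ioi (0:ℝ), (δ (y - 5 * κ) : ℂ) * Complex.exp (-(p * y))‖
      ≤ ∫ y in Set.Ioi (0:ℝ), δ (y - 5 * κ) * Real.exp (-s) := by
    apply norm_integral_le_of_norm_le hI.integrableOn
    refine Filter.Eventually.of_forall fun y => ?_
    rw [norm_mul, Complex.norm_real, Real.norm_of_nonneg (hδnonneg _), Complex.norm_exp]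
    by_cases h : κ ≤ |y - 5 * κ|
    · simp [hδsupp _ h]
    · have h' := (abs_lt.mp (not_le.mp h)).1
      refine mul_le_mul_of_nonneg_left (Real.exp_le_exp.mpr ?_) (hδnonneg _)
      simp only [Complex.neg_re, Complex.mul_re, Complex.ofReal_re, Complex.ofReal_im]
      nlinarith
  have h2 : ∫ y in Set.Ioi (0:ℝ), δ (y - 5 * κ) * Real.exp (-s) ≤ Real.exp (-s) := by
    refine (setIntegral_le_integral hI (Filter.Eventually.of_forall fun y =>
      mul_nonneg (hδnonneg _) (Real.exp_pos _).le)).trans ?_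
    rw [integral_mul_const, integral_sub_right_eq_self δ (5 * κ), hδnorm, one_mul]
  have h3 := (Complex.re_le_norm _).trans (h1.trans h2)
  rw [Complex.add_re, Complex.neg_re, Complex.one_re]
  have h4 : Real.exp (-s) * (1 + s) ≤ 1 := by
    have := Real.add_one_le_exp s
    have e : Real.exp (-s) * Real.exp s = 1 := by rw [← Real.exp_add]; simp
    nlinarith [Real.exp_pos (-s)]
  have h5 : min (4 * Real.exp (-4) * κ * p.re) (1 / 2) ≤ 1 - Real.exp (-s) := by
    rcases le_total 1 s with h | h
    · refine (min_le_right _ _).trans ?_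
      nlinarith [Real.exp_pos (-s)]
    · refine (min_le_left _ _).trans ?_
      have h6 : Real.exp (-4) ≤ 1 / 2 := by
        have := Real.add_one_le_exp (4:ℝ)
        have e : Real.exp (-4) * Real.exp 4 = 1 := by rw [← Real.exp_add]; simp
        nlinarith [Real.exp_pos (-4)]
      have h7 : 4 * Real.exp (-4) * κ * p.re = Real.exp (-4) * s := by rw [hs]; ring
      rw [h7]
      have h8 : Real.exp (-s) ≤ 1 - s / 2 := by
        have : (1:ℝ) ≤ (1 - s / 2) * (1 + s) := by nlinarith
        exact le_of_mul_le_mul_right (h4.trans this) (by linarith)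
      nlinarith
  linarith
end

section
/- Let N be a positive integer, h > 0, and 0 < δ₁ < h. For integers 1 ≤ i, j ≤ N define on [0, h] the kernels η_{ij}(y) = i·j·y·sinh((i+j)(h−y)) + h·i·j·cosh(h·i − (i+j)·y)/sinh(j·h) − i·cosh(j(h−y))·cosh(i(h−y)) and η̃_{ij}(y) = i·j·y·sinh((i−j)(h−y)) − h·i·j·cosh(h·i − (i−j)·y)/sinh(j·h) + i·cosh(j(h−y))·cosh(i(h−y)). Then for arbitrary real numbers A_{ij} (1 ≤ i, j ≤ N), B_{ij} (1 ≤ i ≤ j ≤ N), and C_{ij} (1 ≤ j < i ≤ N), there exist C^∞ functions û_m : [0,h] → ℝ, m = 0, 1, …, 2N, each vanishing outside (δ₁, h), such that ∫₀ʰ η̃_{ij}(y)·û_{i+j}(y) dy = A_{ij} for all 1 ≤ i, j ≤ N, ∫₀ʰ η_{ij}(y)·û_{j−i}(y) dy = B_{ij} for all 1 ≤ i ≤ j ≤ N, and ∫₀ʰ η_{ij}(y)·û_{i−j}(y) dy = C_{ij} for all 1 ≤ j < i ≤ N. -/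
/-- The kernel `η_{ij}` (formula (eta1) of the paper). -/
noncomputable def etaKernel (h : ℝ) (i j : ℕ) (y : ℝ) : ℝ :=
  (i : ℝ) * j * y * Real.sinh (((i : ℝ) + j) * (h - y))
    + h * i * j * Real.cosh (h * i - ((i : ℝ) + j) * y) / Real.sinh (j * h)
    - (i : ℝ) * Real.cosh ((j : ℝ) * (h - y)) * Real.cosh ((i : ℝ) * (h - y))

/-- The kernel `η̃_{ij}` (formula (eta2) of the paper). -/
noncomputable def etaTildeKernel (h : ℝ) (i j : ℕ) (y : ℝ) : ℝ :=
  (i : ℝ) * j * y * Real.sinh (((i : ℝ) - j) * (h - y))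
    - h * i * j * Real.cosh (h * i - ((i : ℝ) - j) * y) / Real.sinh (j * h)
    + (i : ℝ) * Real.cosh ((j : ℝ) * (h - y)) * Real.cosh ((i : ℝ) * (h - y))

open scoped ContDiff

section
open Filter Topology

lemma exists_moment {ι : Type*} [Fintype ι] (h δ : ℝ) (hδ : 0 < δ) (hδh : δ < h)
    (f : ι → ℝ → ℝ) (hf : ∀ k, ContDiff ℝ ω (f k))
    (ind : ∀ c : ι → ℝ, (∀ y, ∑ k, c k * f k y = 0) → c = 0) (T : ι → ℝ) :
    ∃ u : ℝ → ℝ, ContDiff ℝ (⊤ : ℕ∞) u ∧ (∀ y, y ∉ Set.Ioo δ h → u y = 0) ∧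
      ∀ k, (∫ y in (0:ℝ)..h, f k y * u y) = T k := by
  classical
  let φ : ContDiffBump ((δ + h) / 2) :=
    { rIn := (h - δ) / 4, rOut := (h - δ) / 2, rIn_pos := by linarith, rIn_lt_rOut := by linarith }
  have hball : Metric.ball ((δ + h) / 2) φ.rOut = Set.Ioo δ h := by
    rw [Real.ball_eq_Ioo]
    congr 1 <;> simp only [φ] <;> ring
  have hφ0 : ∀ y, y ∉ Set.Ioo δ h → φ y = 0 := by
    intro y hy
    rw [← hball, ← φ.support_eq] at hy
    simpa using hy
  have hφpos : ∀ y ∈ Set.Ioo δ h, 0 < φ y := by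
    intro y hy
    rw [← hball] at hy
    exact φ.pos_of_mem_ball hy
  have hfc : ∀ k, Continuous (f k) := fun k => (hf k).continuous
  have hφc : Continuous φ := φ.continuous
  let G : (ι → ℝ) →ₗ[ℝ] (ι → ℝ) :=
    Matrix.toLin' (Matrix.of fun k l => ∫ y in (0:ℝ)..h, f k y * (φ y * f l y))
  have hG : ∀ c k, G c k = ∫ y in (0:ℝ)..h, f k y * (φ y * ∑ l, c l * f l y) := by
    intro c k
    simp only [G, Matrix.toLin'_apply, Matrix.mulVec, dotProduct, Matrix.of_apply]
    simp_rw [← intervalIntegral.integral_mul_const]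
    rw [← intervalIntegral.integral_finsetSum]
    · congr 1
      ext y
      simp only [Finset.mul_sum]
      refine Finset.sum_congr rfl fun l _ => by ring
    · intro l _
      apply Continuous.intervalIntegrable
      fun_prop
  have inj : Function.Injective G := by
    rw [injective_iff_map_eq_zero]
    intro c hc
    have hq : (∫ y in (0:ℝ)..h, φ y * (∑ l, c l * f l y) ^ 2) = 0 := by
      have : ∑ k, c k * G c k = 0 := by simp [hc]
      refine Eq.trans ?_ this
      simp_rw [hG, ← intervalIntegral.integral_const_mul]
      rw [← intervalIntegral.integral_finsetSum]
      · congr 1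
        ext y
        rw [pow_two]
        conv_lhs => rw [← mul_assoc, mul_comm, Finset.sum_mul]
        refine Finset.sum_congr rfl fun l _ => by ring
      · intro l _
        apply Continuous.intervalIntegrable
        fun_prop
    have hz : ∀ y ∈ Set.Ioo δ h, ∑ l, c l * f l y = 0 := by
      intro y hy
      by_contra hne
      have : 0 < ∫ y in (0:ℝ)..h, φ y * (∑ l, c l * f l y) ^ 2 := by
        apply intervalIntegral.integral_pos (by linarith)
        · apply Continuous.continuousOn
          fun_prop
        · intro x _
          have := φ.nonneg (x := x)
          positivity
        · refine ⟨y, ⟨by linarith [hy.1], hy.2.le⟩, ?_⟩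
          have := hφpos y hy
          positivity
      linarith
    apply ind
    have han : AnalyticOnNhd ℝ (fun y => ∑ l, c l * f l y) Set.univ := by
      apply ContDiff.analyticOnNhd
      exact ContDiff.sum fun l _ => contDiff_const.mul (hf l)
    have := han.eqOn_zero_of_preconnected_of_eventuallyEq_zero isPreconnected_univ
      (Set.mem_univ ((δ + h) / 2)) (by
        filter_upwards [Ioo_mem_nhds (show δ < (δ+h)/2 by linarith) (show (δ+h)/2 < h by linarith)]
          with y hy using hz y hy)
    intro y
    exact this (Set.mem_univ y)
  obtain ⟨c, hc⟩ := (LinearMap.injective_iff_surjective.1 inj) T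
  refine ⟨fun y => φ y * ∑ l, c l * f l y, ?_, ?_, ?_⟩
  · exact φ.contDiff.mul (ContDiff.sum fun l _ => contDiff_const.mul ((hf l).of_le (by simp)))
  · intro y hy
    simp [hφ0 y hy]
  · intro k
    rw [← hG, hc]

lemma sinh_lt_mul_cosh {x : ℝ} (hx : 0 < x) : Real.sinh x < x * Real.cosh x := by
  obtain ⟨c, hc, hc'⟩ := exists_hasDerivAt_eq_slope Real.sinh Real.cosh hx
    Real.continuous_sinh.continuousOn (fun y _ => Real.hasDerivAt_sinh y)
  have h1 : Real.cosh c < Real.cosh x := by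
    rw [Real.cosh_lt_cosh, abs_of_pos hc.1, abs_of_pos hx]; exact hc.2
  rw [hc', Real.sinh_zero, sub_zero, sub_zero, div_lt_iff₀ hx] at h1
  linarith

lemma sinh_div_mono {x y : ℝ} (hx : 0 < x) (hxy : x < y) :
    Real.sinh x / x < Real.sinh y / y := by
  have hc : StrictConvexOn ℝ (Set.Ici (0:ℝ)) Real.sinh := by
    apply strictConvexOn_of_deriv2_pos (convex_Ici 0) Real.continuous_sinh.continuousOn
    intro x hx
    simp at hx ⊢
    exact hx
  simpa using hc.secant_strict_mono (a := 0) (x := x) (y := y) (by simp) (by simp; linarith)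
    (by simp; linarith) hx.ne' (by linarith) hxy

lemma degenerate_unique {c x y : ℝ} (hc : 0 < c) (hx : 0 < x) (hy : 0 < y)
    (h1 : 2 * x * (x + c) * Real.sinh c = c * Real.sinh x * Real.sinh (x + c))
    (h2 : 2 * y * (y + c) * Real.sinh c = c * Real.sinh y * Real.sinh (y + c)) : x = y := by
  have key : ∀ {x y : ℝ}, 0 < x → x < y →
      2 * x * (x + c) * Real.sinh c = c * Real.sinh x * Real.sinh (x + c) →
      2 * y * (y + c) * Real.sinh c = c * Real.sinh y * Real.sinh (y + c) → False := by
    intro x y hx hxy h1 h2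
    have hy : 0 < y := hx.trans hxy
    have a1 := sinh_div_mono hx hxy
    have a2 := sinh_div_mono (show 0 < x + c by linarith) (show x + c < y + c by linarith)
    have p1 : 0 < Real.sinh x / x := div_pos (Real.sinh_pos_iff.2 hx) hx
    have p2 : 0 < Real.sinh (x+c) / (x+c) :=
      div_pos (Real.sinh_pos_iff.2 (by linarith)) (by linarith)
    have a3 := mul_lt_mul'' a1 a2 p1.le p2.le
    have e : ∀ {x : ℝ}, 0 < x →
        2 * x * (x + c) * Real.sinh c = c * Real.sinh x * Real.sinh (x + c) →
        Real.sinh x / x * (Real.sinh (x+c) / (x+c)) = 2 * Real.sinh c / c := by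
      intro x hx h1
      have : x + c ≠ 0 := by positivity
      field_simp
      linarith
    rw [e hx h1, e hy h2] at a3
    exact lt_irrefl _ a3
  rcases lt_trichotomy x y with h | h | h
  · exact (key hx h h1 h2).elim
  · exact h
  · exact (key hy h h2 h1).elim

lemma tend_exp {b : ℝ} (hb : 0 < b) :
    Tendsto (fun z : ℝ => Real.exp (-b * z)) atTop (𝓝 0) := by
  simpa using tendsto_rpow_mul_exp_neg_mul_atTop_nhds_zero 0 b hb

lemma tend_mul_exp {b : ℝ} (hb : 0 < b) :
    Tendsto (fun z : ℝ => z * Real.exp (-b * z)) atTop (𝓝 0) := by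
  simpa using tendsto_rpow_mul_exp_neg_mul_atTop_nhds_zero 1 b hb

lemma cosh_mul_exp (k a z : ℝ) : Real.cosh (k * z) * Real.exp (-a * z) =
    (Real.exp (-(a - k) * z) + Real.exp (-(a + k) * z)) / 2 := by
  rw [Real.cosh_eq, div_mul_eq_mul_div, add_mul, ← Real.exp_add, ← Real.exp_add]
  ring_nf

lemma sinh_mul_exp (k a z : ℝ) : Real.sinh (k * z) * Real.exp (-a * z) =
    (Real.exp (-(a - k) * z) - Real.exp (-(a + k) * z)) / 2 := by
  rw [Real.sinh_eq, div_mul_eq_mul_div, sub_mul, ← Real.exp_add, ← Real.exp_add]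
  ring_nf

lemma freq_indep (S : Finset ℕ) (α β : ℕ → ℝ)
    (H : ∀ z : ℝ, ∑ n ∈ S, (α n * Real.cosh (n * z) + β n * (z * Real.sinh (n * z))) = 0) :
    ∀ n ∈ S, α n = 0 ∧ (n ≠ 0 → β n = 0) := by
  induction S using Finset.induction_on_max with
  | empty => simp
  | insert a s hs ih =>
    have has : a ∉ s := fun h => lt_irrefl _ (hs a h)
    simp_rw [Finset.sum_insert has] at H
    have ha : α a = 0 ∧ (a ≠ 0 → β a = 0) := by
      rcases Nat.eq_zero_or_pos a with h0 | hpos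
      · have : s = ∅ := by
          apply Finset.eq_empty_of_forall_notMem
          intro x hx
          have := hs x hx
          omega
        have H0 := H 0
        simp [this] at H0
        exact ⟨H0, fun h => (h h0).elim⟩
      · have hA : (0:ℝ) < a := by exact_mod_cast hpos
        have hrest : Tendsto (fun z : ℝ => ∑ n ∈ s,
            (α n * (Real.cosh (n * z) * Real.exp (-a * z)) +
              β n * (z * (Real.sinh (n * z) * Real.exp (-a * z))))) atTop (𝓝 0) := by
          rw [show (0:ℝ) = ∑ n ∈ s, (α n * ((0 + 0) / 2) + β n * ((0 - 0) / 2)) by simp]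
          refine tendsto_finsetSum _ fun n hn => ?_
          have hna : (n:ℝ) < a := by exact_mod_cast hs n hn
          have p1 : (0:ℝ) < a - n := by linarith
          have p2 : (0:ℝ) < a + n := by positivity
          simp_rw [cosh_mul_exp, sinh_mul_exp]
          refine Tendsto.add (Tendsto.const_mul _ (((tend_exp p1).add (tend_exp p2)).div_const 2))
            (Tendsto.const_mul _ ?_)
          refine Tendsto.congr ?_ (((tend_mul_exp p1).sub (tend_mul_exp p2)).div_const 2)
          intro z
          ring
        have p2 : (0:ℝ) < a + a := by positivity
        have hc : Tendsto (fun z : ℝ => Real.cosh (a * z) * Real.exp (-a * z)) atTop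
            (𝓝 (1/2)) := by
          simp_rw [cosh_mul_exp]
          simpa using (((tendsto_const_nhds (x := (1:ℝ))).add (tend_exp p2)).div_const 2)
        have hsn : Tendsto (fun z : ℝ => Real.sinh (a * z) * Real.exp (-a * z)) atTop
            (𝓝 (1/2)) := by
          simp_rw [sinh_mul_exp]
          simpa using (((tendsto_const_nhds (x := (1:ℝ))).sub (tend_exp p2)).div_const 2)
        have hβ : Tendsto (fun z : ℝ => z * (β a * (Real.sinh (a * z) * Real.exp (-a * z)))) atTop
            (𝓝 (-(α a * (1/2) + 0))) := by
          refine Tendsto.congr ?_ ((hc.const_mul (α a)).add hrest).neg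
          intro z
          have := congrArg (· * Real.exp (-a * z)) (H z)
          simp only [zero_mul, add_mul, Finset.sum_mul] at this
          rw [Finset.sum_congr rfl (g := fun n => (α n * Real.cosh (n * z) * Real.exp (-a * z) +
              β n * (z * Real.sinh (n * z)) * Real.exp (-a * z))) (fun n _ => by ring)]
          linarith
        have hb0 : β a = 0 := by
          have h1 := (tendsto_inv_atTop_zero (𝕜 := ℝ)).mul hβ
          have h2 : Tendsto (fun z : ℝ => β a * (Real.sinh (a * z) * Real.exp (-a * z))) atTop
              (𝓝 (0 * (-(α a * (1/2) + 0)))) := by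
            refine Tendsto.congr' ?_ h1
            filter_upwards [eventually_gt_atTop 0] with z hz
            field_simp
          have := tendsto_nhds_unique h2 (hsn.const_mul (β a))
          linarith
        refine ⟨?_, fun _ => hb0⟩
        simp only [hb0, zero_mul, mul_zero] at hβ
        have := tendsto_nhds_unique hβ tendsto_const_nhds
        linarith
    have hz : ∀ z : ℝ, α a * Real.cosh (a * z) + β a * (z * Real.sinh (a * z)) = 0 := by
      intro z
      rcases eq_or_ne a 0 with h | h
      · rw [ha.1]; simp [h]
      · rw [ha.1, ha.2 h]; simp
    intro n hn
    rcases Finset.mem_insert.1 hn with rfl | hn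
    · exact ha
    · refine ih (fun z => ?_) n hn
      have := H z
      rw [hz z, zero_add] at this
      exact this

/-- The coefficient of `cosh ((i+j) z)`. -/
noncomputable def gco (h : ℝ) (p : ℤ × ℤ) : ℝ :=
  p.1 * (p.2 * h * Real.cosh (p.2 * h) / Real.sinh (p.2 * h) - 1 / 2)

/-- Unified kernel. -/
noncomputable def Kf (h : ℝ) (p : ℤ × ℤ) (y : ℝ) : ℝ :=
  -(p.1 * p.2 * ((h - y) * Real.sinh ((p.1 + p.2) * (h - y))))
    + gco h p * Real.cosh ((p.1 + p.2) * (h - y))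
    - p.1 / 2 * Real.cosh ((p.1 - p.2) * (h - y))

lemma Kf_contDiff (h : ℝ) (p : ℤ × ℤ) : ContDiff ℝ ω (Kf h p) := by
  unfold Kf
  have h1 : ContDiff ℝ ω Real.sinh := Real.contDiff_sinh
  have h2 : ContDiff ℝ ω Real.cosh := Real.contDiff_cosh
  fun_prop

/-- reflected sign -/
noncomputable def bco (p : ℤ × ℤ) : ℝ := -(p.1 * p.2 * (p.1 + p.2).sign)

lemma extract (h : ℝ) (m : ℕ) (I : Finset (ℤ × ℤ))
    (hI : ∀ p ∈ I, 0 < p.1 ∧ p.2 ≠ 0 ∧ (p.1 - p.2).natAbs = m) (c : ℤ × ℤ → ℝ)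
    (H : ∀ y, ∑ p ∈ I, c p * Kf h p y = 0) :
    (∀ p ∈ I, ∑ q ∈ I with (q.1 + q.2).natAbs = (p.1 + p.2).natAbs, c q * gco h q = 0) ∧
    (∀ p ∈ I, p.1 + p.2 ≠ 0 →
      ∑ q ∈ I with (q.1 + q.2).natAbs = (p.1 + p.2).natAbs, c q * bco q = 0) ∧
    ∑ p ∈ I, c p * p.1 = 0 := by
  classical
  have hm : ∀ p ∈ I, (p.1 + p.2).natAbs ≠ m := by
    intro p hp
    have := hI p hp
    omega
  have key := freq_indep (insert m (I.image fun p => (p.1 + p.2).natAbs))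
    (fun n => ∑ q ∈ I with (q.1 + q.2).natAbs = n, c q * gco h q
      + if n = m then -(∑ p ∈ I, c p * p.1) / 2 else 0)
    (fun n => ∑ q ∈ I with (q.1 + q.2).natAbs = n, c q * bco q) (by
      intro z
      refine Eq.trans ?_ (H (h - z))
      simp only [add_mul, Finset.sum_add_distrib, ite_mul, zero_mul, Finset.sum_mul]
      rw [Finset.sum_ite_eq' ]
      simp only [Finset.mem_insert_self, if_true]
      have e1 : ∀ F : ℤ × ℤ → ℕ → ℝ, ∑ n ∈ insert m (I.image fun p => (p.1 + p.2).natAbs),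
          ∑ q ∈ I with (q.1 + q.2).natAbs = n, F q n = ∑ q ∈ I, F q (q.1 + q.2).natAbs := by
        intro F
        rw [← Finset.sum_fiberwise_of_maps_to (s := I)
          (t := insert m (I.image fun p => (p.1 + p.2).natAbs))
          (g := fun p => (p.1 + p.2).natAbs)]
        · refine Finset.sum_congr rfl fun n _ => Finset.sum_congr rfl fun q hq => ?_
          rw [(Finset.mem_filter.1 hq).2]
        · intro p hp
          exact Finset.mem_insert_of_mem (Finset.mem_image_of_mem _ hp)
      rw [e1 (fun q n => c q * gco h q * Real.cosh (n * z)),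
        e1 (fun q n => c q * bco q * (z * Real.sinh (n * z)))]
      rw [neg_div, neg_mul, Finset.sum_div, Finset.sum_mul, ← Finset.sum_neg_distrib,
        ← Finset.sum_add_distrib, ← Finset.sum_add_distrib]
      refine Finset.sum_congr rfl fun p hp => ?_
      have habs : ∀ (k : ℤ), Real.cosh ((k.natAbs : ℕ) * z) = Real.cosh (k * z) ∧
          (k.sign : ℝ) * Real.sinh ((k.natAbs : ℕ) * z) = Real.sinh (k * z) := by
        intro k
        rcases lt_trichotomy k 0 with hk | hk | hk
        · have : ((k.natAbs : ℕ) : ℝ) = -k := by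
            rw [Nat.cast_natAbs, abs_of_neg hk, Int.cast_neg]
          rw [this, Int.sign_eq_neg_one_of_neg hk]
          simp
        · simp [hk]
        · have : ((k.natAbs : ℕ) : ℝ) = k := by
            rw [Nat.cast_natAbs, abs_of_pos hk]
          rw [this, Int.sign_eq_one_of_pos hk]
          simp
      have a1 := habs (p.1 + p.2)
      have a2 := (habs (p.1 - p.2)).1
      rw [(hI p hp).2.2] at a2
      unfold Kf bco
      rw [a1.1, a2, sub_sub_cancel]
      push_cast at a1 ⊢
      rw [← a1.2]
      ring)
  refine ⟨fun p hp => ?_, fun p hp hne => ?_, ?_⟩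
  · have := (key _ (Finset.mem_insert_of_mem (Finset.mem_image_of_mem _ hp))).1
    simpa [hm p hp] using this
  · exact (key _ (Finset.mem_insert_of_mem (Finset.mem_image_of_mem _ hp))).2 (by omega)
  · have := (key _ (Finset.mem_insert_self _ _)).1
    rw [Finset.filter_false_of_mem hm] at this
    simp at this
    linarith

lemma half_lt_coth {x : ℝ} (hx : x ≠ 0) : 1 / 2 < x * Real.cosh x / Real.sinh x := by
  have key : ∀ {x : ℝ}, 0 < x → 1 / 2 < x * Real.cosh x / Real.sinh x := by
    intro x hx
    have h1 := sinh_lt_mul_cosh hx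
    have h2 := Real.sinh_pos_iff.2 hx
    rw [lt_div_iff₀ h2]
    linarith
  rcases lt_or_gt_of_ne hx with h | h
  · have := key (neg_pos.2 h)
    simpa using this
  · exact key h

lemma gco_pos {h : ℝ} (hh : 0 < h) {p : ℤ × ℤ} (h1 : 0 < p.1) (h2 : p.2 ≠ 0) :
    0 < gco h p := by
  unfold gco
  have h1' : (0:ℝ) < p.1 := by exact_mod_cast h1
  have h2' : (p.2:ℝ) ≠ 0 := by exact_mod_cast h2
  have := half_lt_coth (mul_ne_zero h2' hh.ne')
  exact mul_pos h1' (by linarith)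

/-- Degeneracy: equality of the coefficients for `(i,j)` and `(j,i)`. -/
lemma gco_degenerate {h : ℝ} (hh : 0 < h) {i j : ℤ} (hi : 0 < i) (hj : i < j)
    (e : gco h (i, j) = gco h (j, i)) :
    2 * (i * h) * (i * h + (j - i) * h) * Real.sinh ((j - i) * h) =
      (j - i) * h * Real.sinh (i * h) * Real.sinh (i * h + (j - i) * h) := by
  have hi' : (0:ℝ) < i := by exact_mod_cast hi
  have hj' : (0:ℝ) < j := by exact_mod_cast hi.trans hj
  have s1 := (Real.sinh_pos_iff.2 (mul_pos hi' hh)).ne'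
  have s2 := (Real.sinh_pos_iff.2 (mul_pos hj' hh)).ne'
  have e1 : (i:ℝ) * h + (j - i) * h = j * h := by ring
  have e2 : ((j:ℝ) - i) * h = j * h - i * h := by ring
  rw [e1, e2, Real.sinh_sub]
  simp only [gco] at e
  field_simp at e
  linear_combination -h * e

lemma indep {h : ℝ} (hh : 0 < h) (m : ℕ) (I : Finset (ℤ × ℤ))
    (hI : ∀ p ∈ I, 0 < p.1 ∧ p.2 ≠ 0 ∧ (p.1 - p.2).natAbs = m)
    (hs1 : ∀ p ∈ I, 0 < p.2 → (p.2, p.1) ∈ I)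
    (hs2 : ∀ p ∈ I, p.2 < 0 → (-p.2, -p.1) ∈ I)
    (c : ℤ × ℤ → ℝ) (H : ∀ y, ∑ p ∈ I, c p * Kf h p y = 0) :
    ∀ p ∈ I, c p = 0 := by
  classical
  obtain ⟨hα, hβ, hsum⟩ := extract h m I hI c H
  -- negative second index
  have hneg : ∀ p ∈ I, p.2 < 0 → c p = 0 := by
    rintro ⟨i, j⟩ hp hj
    have hp0 := hI _ hp
    have hq := hs2 _ hp hj
    have hq0 := hI _ hq
    have A := hα _ hp
    have B := hβ _ hp
    have g1 := gco_pos hh hp0.1 hp0.2.1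
    have g2 := gco_pos hh hq0.1 hq0.2.1
    have hfil : (I.filter fun q => (q.1 + q.2).natAbs = (i + j).natAbs) = {(i, j), (-j, -i)} := by
      ext ⟨k, l⟩
      simp only [Finset.mem_filter, Finset.mem_insert, Finset.mem_singleton, Prod.mk.injEq]
      constructor
      · rintro ⟨h1, h2⟩
        have := hI _ h1
        simp only at this hp0 hj
        omega
      · rintro (⟨rfl, rfl⟩ | ⟨rfl, rfl⟩)
        · exact ⟨hp, rfl⟩
        · exact ⟨hq, by omega⟩
    simp only [hfil] at A B
    by_cases hz : i + j = 0
    · obtain rfl : j = -i := by omega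
      simp at A
      exact A.resolve_right g1.ne'
    · have hne : ((i, j) : ℤ × ℤ) ≠ (-j, -i) := by
        intro h
        have := congrArg Prod.fst h
        simp only at this
        omega
      rw [Finset.sum_pair hne] at A B
      have B := B hz
      simp only [bco] at B
      rw [show -j + -i = -(i + j) by ring, Int.sign_neg] at B
      push_cast at B
      have hs : (((i + j).sign : ℤ) : ℝ) ≠ 0 := by
        have : (i + j).sign ≠ 0 := by simpa [Int.sign_eq_zero_iff_zero] using hz
        exact_mod_cast this
      have hi' : (i : ℝ) ≠ 0 := by exact_mod_cast hp0.1.ne'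
      have hj' : (j : ℝ) ≠ 0 := by exact_mod_cast hj.ne
      have B' : c (i, j) - c (-j, -i) = 0 := by
        have : ((i : ℝ) * j * ((i + j).sign : ℤ)) * (c (i, j) - c (-j, -i)) = 0 := by
          linear_combination -B
        exact (mul_eq_zero.1 this).resolve_left (mul_ne_zero (mul_ne_zero hi' hj') hs)
      have : c (i, j) * (gco h (i, j) + gco h (-j, -i)) = 0 := by
        linear_combination A + gco h (-j, -i) * B'
      exact (mul_eq_zero.1 this).resolve_right (by positivity)
  have hpos : ∀ p ∈ I, 0 < p.2 → (p.1 = p.2 → c p = 0) ∧ c p + c (p.2, p.1) = 0 ∧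
      (c p = 0 ∨ gco h p = gco h (p.2, p.1)) := by
    rintro ⟨i, j⟩ hp hj
    have hp0 := hI _ hp
    have hq := hs1 _ hp hj
    have hq0 := hI _ hq
    simp only at hj hp0 hq hq0 ⊢
    have A := hα _ hp
    have B := hβ _ hp (by simp only; omega)
    have hfil : (I.filter fun q => (q.1 + q.2).natAbs = (i + j).natAbs) = {(i, j), (j, i)} := by
      ext ⟨k, l⟩
      simp only [Finset.mem_filter, Finset.mem_insert, Finset.mem_singleton, Prod.mk.injEq]
      constructor
      · rintro ⟨h1, h2⟩
        have := hI _ h1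
        simp only at this
        omega
      · rintro (⟨rfl, rfl⟩ | ⟨rfl, rfl⟩)
        · exact ⟨hp, rfl⟩
        · exact ⟨hq, by omega⟩
    simp only [hfil] at A B
    have hi' : (i : ℝ) ≠ 0 := by exact_mod_cast hp0.1.ne'
    have hj' : (j : ℝ) ≠ 0 := by exact_mod_cast hj.ne'
    by_cases hz : i = j
    · subst hz
      simp [bco, hi', Int.sign_eq_zero_iff_zero] at B
      have hc : c (i, i) = 0 := by
        rcases B with B | B
        · exact B
        · exfalso; omega
      exact ⟨fun _ => hc, by simp [hc], Or.inl hc⟩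
    · refine ⟨fun h => (hz h).elim, ?_⟩
      have hne : ((i, j) : ℤ × ℤ) ≠ (j, i) := by
        intro h
        exact hz (congrArg Prod.fst h)
      rw [Finset.sum_pair hne] at A B
      simp only [bco] at B
      rw [add_comm j i, Int.sign_eq_one_of_pos (by omega)] at B
      push_cast at B
      have B' : c (i, j) + c (j, i) = 0 := by
        have : ((i : ℝ) * j) * (c (i, j) + c (j, i)) = 0 := by linear_combination -B
        exact (mul_eq_zero.1 this).resolve_left (mul_ne_zero hi' hj')
      refine ⟨B', ?_⟩
      have : c (i, j) * (gco h (i, j) - gco h (j, i)) = 0 := by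
        linear_combination A - gco h (j, i) * B'
      rcases mul_eq_zero.1 this with h | h
      · exact Or.inl h
      · exact Or.inr (by linarith)
  -- uniqueness of degenerate pair
  have hlt : ∀ p ∈ I, 0 < p.2 → p.1 < p.2 → c p = 0 := by
    rintro ⟨i, j⟩ hp hj hij
    by_contra hne
    have hp0 := hI _ hp
    obtain ⟨-, hcc, hd⟩ := hpos _ hp hj
    have hd := hd.resolve_left hne
    have hq := hs1 _ hp hj
    simp only at hj hij hp0 hcc hd hq
    have D1 := gco_degenerate hh hp0.1 hij hd
    have huniq : ∀ k l : ℤ, (k, l) ∈ I → 0 < k → k < l → gco h (k, l) = gco h (l, k) → k = i := by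
      intro k l hkl hk hlt e
      have D2 := gco_degenerate hh hk hlt e
      have hk0 := hI _ hkl
      simp only at hk0
      have hd : (l:ℝ) - k = j - i := by
        have : l - k = j - i := by omega
        exact_mod_cast this
      rw [hd] at D2
      have hm : (0:ℝ) < j - i := by
        have : (0:ℤ) < j - i := by omega
        exact_mod_cast this
      have hi' : (0:ℝ) < i := by exact_mod_cast hp0.1
      have hk' : (0:ℝ) < k := by exact_mod_cast hk
      have := degenerate_unique (mul_pos hm hh) (mul_pos hk' hh) (mul_pos hi' hh) D2 D1
      have := mul_right_cancel₀ hh.ne' this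
      exact_mod_cast this
    have hsub : ∑ p ∈ I, c p * p.1 = ∑ p ∈ ({(i, j), (j, i)} : Finset (ℤ × ℤ)), c p * p.1 := by
      symm
      apply Finset.sum_subset
      · intro q hq'
        simp only [Finset.mem_insert, Finset.mem_singleton] at hq'
        rcases hq' with rfl | rfl
        · exact hp
        · exact hq
      · rintro ⟨k, l⟩ hkl hnot
        simp only [Finset.mem_insert, Finset.mem_singleton, Prod.mk.injEq] at hnot
        have hk0 := hI _ hkl
        simp only at hk0
        have : c (k, l) = 0 := by
          rcases lt_or_gt_of_ne hk0.2.1 with hl | hl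
          · exact hneg _ hkl hl
          · obtain ⟨-, hcc', hd'⟩ := hpos _ hkl hl
            rcases hd' with h | h
            · exact h
            · exfalso
              simp only at h
              rcases lt_trichotomy k l with hkl' | hkl' | hkl'
              · have := huniq k l hkl hk0.1 hkl' h
                omega
              · omega
              · have := huniq l k (hs1 _ hkl hl) hl hkl' h.symm
                omega
        rw [this, zero_mul]
    rw [hsub, Finset.sum_pair (by intro h; have := congrArg Prod.fst h; simp only at this; omega)]
      at hsum
    simp only at hsum
    have : c (i, j) * ((i:ℝ) - j) = 0 := by linear_combination hsum - j * hcc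
    rcases mul_eq_zero.1 this with h | h
    · exact hne h
    · have : (i:ℝ) = j := by linarith
      have : i = j := by exact_mod_cast this
      omega
  rintro ⟨i, j⟩ hp
  have hp0 := hI _ hp
  simp only at hp0
  rcases lt_or_gt_of_ne hp0.2.1 with hj | hj
  · exact hneg _ hp hj
  · rcases lt_trichotomy i j with h | h | h
    · exact hlt _ hp hj h
    · exact (hpos _ hp hj).1 h
    · have h1 := hlt _ (hs1 _ hp hj) hp0.1 h
      have h2 := (hpos _ hp hj).2.1
      simp only at h1 h2
      linarith

lemma eta_eq {h : ℝ} (hh : 0 < h) (i j : ℕ) (hj : 1 ≤ j) (y : ℝ) :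
    etaKernel h i j y = Kf h ((i : ℤ), (j : ℤ)) y := by
  have hj' : (0:ℝ) < j := by exact_mod_cast hj
  have s2 := (Real.sinh_pos_iff.2 (mul_pos hj' hh)).ne'
  obtain ⟨z, rfl⟩ : ∃ z, y = h - z := ⟨h - y, by ring⟩
  unfold etaKernel Kf gco
  simp only [Int.cast_natCast, sub_sub_cancel]
  rw [show h * i - ((i:ℝ) + j) * (h - z) = (i + j) * z - j * h by ring, Real.cosh_sub,
    add_mul, sub_mul, Real.cosh_sub, Real.cosh_add, Real.sinh_add]
  field_simp
  ring

lemma etaTilde_eq {h : ℝ} (hh : 0 < h) (i j : ℕ) (hj : 1 ≤ j) (y : ℝ) :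
    etaTildeKernel h i j y = - Kf h ((i : ℤ), -(j : ℤ)) y := by
  have hj' : (0:ℝ) < j := by exact_mod_cast hj
  have s2 := (Real.sinh_pos_iff.2 (mul_pos hj' hh)).ne'
  obtain ⟨z, rfl⟩ : ∃ z, y = h - z := ⟨h - y, by ring⟩
  unfold etaTildeKernel Kf gco
  simp only [Int.cast_natCast, Int.cast_neg, sub_sub_cancel, neg_mul, Real.cosh_neg, Real.sinh_neg]
  rw [show h * i - ((i:ℝ) - j) * (h - z) = (i - j) * z + j * h by ring, Real.cosh_add,
    sub_neg_eq_add, ← sub_eq_add_neg,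
    add_mul, sub_mul, Real.cosh_sub, Real.cosh_add, Real.sinh_sub]
  field_simp
  ring

end

/-- The solvable moment system (M11)–(M31) of the paper (Lemma 8.1): for
arbitrary targets `A`, `B`, `C` there exist smooth functions `û_m` supported
in `(δ₁, h)` matching all the prescribed moments against the kernels
`η̃_{ij}` and `η_{ij}`. -/
theorem moment_system_solvable (N : ℕ) (hN : 0 < N) (h δ₁ : ℝ)
    (hδ₁ : 0 < δ₁) (hδ₁h : δ₁ < h)
    (A B C : ℕ → ℕ → ℝ) :
    ∃ u : ℕ → ℝ → ℝ,
      (∀ m, ContDiff ℝ (⊤ : ℕ∞) (u m)) ∧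
      (∀ m y, y ∉ Set.Ioo δ₁ h → u m y = 0) ∧
      (∀ i j, 1 ≤ i → i ≤ N → 1 ≤ j → j ≤ N →
        (∫ y in (0:ℝ)..h, etaTildeKernel h i j y * u (i + j) y) = A i j) ∧
      (∀ i j, 1 ≤ i → i ≤ j → j ≤ N →
        (∫ y in (0:ℝ)..h, etaKernel h i j y * u (j - i) y) = B i j) ∧
      (∀ i j, 1 ≤ j → j < i → i ≤ N →
        (∫ y in (0:ℝ)..h, etaKernel h i j y * u (i - j) y) = C i j) := by
  classical
  have hh : 0 < h := hδ₁.trans hδ₁h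
  let I : ℕ → Finset (ℤ × ℤ) := fun m =>
    (Finset.Icc (1:ℤ) N ×ˢ Finset.Icc (-(N:ℤ)) N).filter
      fun p => p.2 ≠ 0 ∧ (p.1 - p.2).natAbs = m
  have memI : ∀ m (p : ℤ × ℤ), p ∈ I m ↔ ((1 ≤ p.1 ∧ p.1 ≤ N) ∧ (-(N:ℤ) ≤ p.2 ∧ p.2 ≤ N)) ∧
      p.2 ≠ 0 ∧ (p.1 - p.2).natAbs = m := by
    intro m p
    simp only [I, Finset.mem_filter, Finset.mem_product, Finset.mem_Icc]
  let T : ℤ × ℤ → ℝ := fun p =>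
    if p.2 < 0 then -A p.1.toNat (-p.2).toNat
    else if p.1 ≤ p.2 then B p.1.toNat p.2.toNat else C p.1.toNat p.2.toNat
  have ex : ∀ m, ∃ u : ℝ → ℝ, ContDiff ℝ (⊤ : ℕ∞) u ∧ (∀ y, y ∉ Set.Ioo δ₁ h → u y = 0) ∧
      ∀ k : I m, (∫ y in (0:ℝ)..h, Kf h k y * u y) = T k := by
    intro m
    refine exists_moment h δ₁ hδ₁ hδ₁h (fun k : I m => Kf h k) (fun k => Kf_contDiff h k) ?_ _
    intro c hc
    have := indep hh m (I m)
      (by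
        intro p hp
        rw [memI] at hp
        exact ⟨by omega, hp.2⟩)
      (by
        intro p hp h0
        rw [memI] at hp ⊢
        simp only
        omega)
      (by
        intro p hp h0
        rw [memI] at hp ⊢
        simp only
        omega)
      (fun p => if hp : p ∈ I m then c ⟨p, hp⟩ else 0)
      (by
        intro y
        rw [← Finset.sum_coe_sort]
        rw [← hc y]
        refine Finset.sum_congr rfl fun k _ => ?_
        simp)
    funext k
    have := this k k.2
    simpa using this
  choose u hu1 hu2 hu3 using ex
  refine ⟨u, hu1, hu2, ?_, ?_, ?_⟩
  · intro i j hi hiN hj hjN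
    have := hu3 (i + j) ⟨((i : ℤ), -(j : ℤ)), by rw [memI]; simp only; omega⟩
    simp_rw [etaTilde_eq hh i j hj, neg_mul, intervalIntegral.integral_neg]
    simp only at this
    rw [this]
    have hj0 : -(j:ℤ) < 0 := by omega
    simp only [T, if_pos hj0, neg_neg, Int.toNat_natCast]
  · intro i j hi hij hjN
    have := hu3 (j - i) ⟨((i : ℤ), (j : ℤ)), by rw [memI]; simp only; omega⟩
    simp_rw [eta_eq hh i j (hi.trans hij)]
    simp only at this
    rw [this]
    simp [T, hij]
  · intro i j hj hji hiN
    have := hu3 (i - j) ⟨((i : ℤ), (j : ℤ)), by rw [memI]; simp only; omega⟩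
    simp_rw [eta_eq hh i j hj]
    simp only at this
    rw [this]
    simp [T, not_le.2 hji]
end

section
/- Let N be a positive integer, h > 0, δ₀ ∈ (0, h/2), and let a₁, …, a_N be nonzero real numbers. Then for arbitrary real numbers f₁⁺, …, f_N⁺ and f₁⁻, …, f_N⁻ there exists a C^∞ function η₁ : ℝ × [0,h] → ℝ that is 2π-periodic in its first variable x, vanishes for y ∉ (δ₀, h), has ∫₀^{2π}∫₀ʰ η₁(x,y) dy dx = 0, and satisfies ∫₀^{2π}∫₀ʰ η₁(x,y)·a_i·cosh(i(h−y))·cos(i·x) dy dx = f_i⁺ and ∫₀^{2π}∫₀ʰ η₁(x,y)·a_i·cosh(i(h−y))·sin(i·x) dy dx = f_i⁻ for every i = 1, …, N. -/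
open intervalIntegral in
lemma hsc_cos (m : ℤ) (hm : m ≠ 0) : ∫ x in (0:ℝ)..(2 * Real.pi), Real.cos ((m:ℝ) * x) = 0 := by
  have hm' : (m:ℝ) ≠ 0 := by exact_mod_cast hm
  rw [integral_comp_mul_left (fun x => Real.cos x) hm', integral_cos]
  have := Real.sin_int_mul_pi (m * 2)
  push_cast at this
  rw [← mul_assoc, this]; simp

open intervalIntegral in
lemma hsc_sin (m : ℤ) : ∫ x in (0:ℝ)..(2 * Real.pi), Real.sin ((m:ℝ) * x) = 0 := by
  by_cases hm : m = 0
  · simp [hm]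
  have hm' : (m:ℝ) ≠ 0 := by exact_mod_cast hm
  rw [integral_comp_mul_left (fun x => Real.sin x) hm', integral_sin]
  have := Real.cos_int_mul_two_pi m
  rw [this]; simp

lemma hsc_cc (i j : ℕ) (hi : 1 ≤ i) : ∫ x in (0:ℝ)..(2 * Real.pi),
    Real.cos ((j:ℝ) * x) * Real.cos ((i:ℝ) * x) = if j = i then Real.pi else 0 := by
  have e : ∀ x : ℝ, Real.cos ((j:ℝ) * x) * Real.cos ((i:ℝ) * x) =
      (Real.cos ((((j:ℤ) - i : ℤ) : ℝ) * x) + Real.cos ((((j:ℤ) + i : ℤ) : ℝ) * x)) * (1/2) := by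
    intro x; push_cast; rw [sub_mul (j:ℝ), add_mul (j:ℝ), Real.cos_sub, Real.cos_add]; ring
  simp_rw [e]
  rw [intervalIntegral.integral_mul_const, intervalIntegral.integral_add
    (Continuous.intervalIntegrable (by fun_prop) _ _)
    (Continuous.intervalIntegrable (by fun_prop) _ _), hsc_cos ((j:ℤ) + i) (by omega)]
  split_ifs with hij
  · subst hij; simp; ring
  · rw [hsc_cos _ (by omega)]; simp

lemma hsc_ss (i j : ℕ) (hi : 1 ≤ i) : ∫ x in (0:ℝ)..(2 * Real.pi),
    Real.sin ((j:ℝ) * x) * Real.sin ((i:ℝ) * x) = if j = i then Real.pi else 0 := by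
  have e : ∀ x : ℝ, Real.sin ((j:ℝ) * x) * Real.sin ((i:ℝ) * x) =
      (Real.cos ((((j:ℤ) - i : ℤ) : ℝ) * x) - Real.cos ((((j:ℤ) + i : ℤ) : ℝ) * x)) * (1/2) := by
    intro x; push_cast; rw [sub_mul (j:ℝ), add_mul (j:ℝ), Real.cos_sub, Real.cos_add]; ring
  simp_rw [e]
  rw [intervalIntegral.integral_mul_const, intervalIntegral.integral_sub
    (Continuous.intervalIntegrable (by fun_prop) _ _)
    (Continuous.intervalIntegrable (by fun_prop) _ _), hsc_cos ((j:ℤ) + i) (by omega)]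
  split_ifs with hij
  · subst hij; simp; ring
  · rw [hsc_cos _ (by omega)]; simp

lemma hsc_sc (i j : ℕ) : ∫ x in (0:ℝ)..(2 * Real.pi),
    Real.sin ((j:ℝ) * x) * Real.cos ((i:ℝ) * x) = 0 := by
  have e : ∀ x : ℝ, Real.sin ((j:ℝ) * x) * Real.cos ((i:ℝ) * x) =
      (Real.sin ((((j:ℤ) - i : ℤ) : ℝ) * x) + Real.sin ((((j:ℤ) + i : ℤ) : ℝ) * x)) * (1/2) := by
    intro x; push_cast; rw [sub_mul (j:ℝ), add_mul (j:ℝ), Real.sin_sub, Real.sin_add]; ring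
  simp_rw [e]
  rw [intervalIntegral.integral_mul_const, intervalIntegral.integral_add
    (Continuous.intervalIntegrable (by fun_prop) _ _)
    (Continuous.intervalIntegrable (by fun_prop) _ _), hsc_sin, hsc_sin]
  simp

/-- Trigonometric polynomial. -/
noncomputable def hscT (N : ℕ) (p q : ℕ → ℝ) (x : ℝ) : ℝ :=
  ∑ j ∈ Finset.Icc 1 N, (p j * Real.cos ((j:ℝ) * x) + q j * Real.sin ((j:ℝ) * x))

lemma hscT_int (N : ℕ) (p q : ℕ → ℝ) (g : ℝ → ℝ) (hg : Continuous g) :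
    ∫ x in (0:ℝ)..(2 * Real.pi), hscT N p q x * g x =
    ∑ j ∈ Finset.Icc 1 N, (p j * (∫ x in (0:ℝ)..(2 * Real.pi), Real.cos ((j:ℝ) * x) * g x)
      + q j * ∫ x in (0:ℝ)..(2 * Real.pi), Real.sin ((j:ℝ) * x) * g x) := by
  unfold hscT
  simp_rw [Finset.sum_mul]
  rw [intervalIntegral.integral_finsetSum
    (fun j _ => Continuous.intervalIntegrable (by fun_prop) _ _)]
  refine Finset.sum_congr rfl fun j _ => ?_
  simp_rw [add_mul, mul_assoc]
  rw [intervalIntegral.integral_add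
    (Continuous.intervalIntegrable (by fun_prop) _ _)
    (Continuous.intervalIntegrable (by fun_prop) _ _),
    intervalIntegral.integral_const_mul, intervalIntegral.integral_const_mul]

lemma hscT_cos (N : ℕ) (p q : ℕ → ℝ) (i : ℕ) (hi : 1 ≤ i) (hiN : i ≤ N) :
    ∫ x in (0:ℝ)..(2 * Real.pi), hscT N p q x * Real.cos ((i:ℝ) * x) = p i * Real.pi := by
  rw [hscT_int N p q _ (by fun_prop)]
  simp_rw [hsc_cc i _ hi, hsc_sc]
  simp [hi, hiN]

lemma hscT_sin (N : ℕ) (p q : ℕ → ℝ) (i : ℕ) (hi : 1 ≤ i) (hiN : i ≤ N) :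
    ∫ x in (0:ℝ)..(2 * Real.pi), hscT N p q x * Real.sin ((i:ℝ) * x) = q i * Real.pi := by
  rw [hscT_int N p q _ (by fun_prop)]
  simp_rw [hsc_ss i _ hi, mul_comm (Real.cos _) (Real.sin _), hsc_sc]
  simp [hi, hiN]

lemma hscT_one (N : ℕ) (p q : ℕ → ℝ) :
    ∫ x in (0:ℝ)..(2 * Real.pi), hscT N p q x = 0 := by
  have := hscT_int N p q (fun _ => 1) (by fun_prop)
  simp only [mul_one] at this
  rw [this]
  refine Finset.sum_eq_zero fun j hj => ?_
  have h1 := hsc_cos j (by have := (Finset.mem_Icc.1 hj).1; omega)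
  have h2 := hsc_sin j
  push_cast at h1 h2
  rw [h1, h2]; simp

/-- Lemma (fcontrol) of the paper: control of the constant terms `f_i^±` by a
smooth, `2π`-periodic-in-`x`, mean-zero heat source correction `η₁` supported
in `δ₀ < y < h`, tested against the conjugate eigenfunction profiles
`a_i·cosh(i(h−y))·cos(ix)` and `a_i·cosh(i(h−y))·sin(ix)`. -/
theorem heat_source_control (N : ℕ) (hN : 0 < N) (h δ₀ : ℝ)
    (hh : 0 < h) (hδ₀ : 0 < δ₀) (hδ₀h : δ₀ < h / 2)
    (a : ℕ → ℝ) (ha : ∀ i, 1 ≤ i → i ≤ N → a i ≠ 0)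
    (fp fm : ℕ → ℝ) :
    ∃ η₁ : ℝ → ℝ → ℝ,
      ContDiff ℝ (⊤ : ℕ∞) (Function.uncurry η₁) ∧
      (∀ x y, η₁ (x + 2 * Real.pi) y = η₁ x y) ∧
      (∀ x y, y ∉ Set.Ioo δ₀ h → η₁ x y = 0) ∧
      (∫ x in (0:ℝ)..(2 * Real.pi), ∫ y in (0:ℝ)..h, η₁ x y) = 0 ∧
      (∀ i, 1 ≤ i → i ≤ N →
        (∫ x in (0:ℝ)..(2 * Real.pi), ∫ y in (0:ℝ)..h,
            η₁ x y * (a i * Real.cosh ((i : ℝ) * (h - y)) * Real.cos ((i : ℝ) * x)))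
          = fp i) ∧
      (∀ i, 1 ≤ i → i ≤ N →
        (∫ x in (0:ℝ)..(2 * Real.pi), ∫ y in (0:ℝ)..h,
            η₁ x y * (a i * Real.cosh ((i : ℝ) * (h - y)) * Real.sin ((i : ℝ) * x)))
          = fm i) := by
  have hd : 0 < (h - δ₀) / 2 := by linarith
  let φ : ContDiffBump ((δ₀ + h) / 2) := ⟨(h - δ₀) / 4, (h - δ₀) / 2, by linarith, by linarith⟩
  have hφs : Function.support φ = Set.Ioo δ₀ h := by
    rw [φ.support_eq, Real.ball_eq_Ioo]
    congr 1 <;> (simp only [φ]; ring)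
  have hφc : Continuous φ := φ.continuous
  have hC : ∀ i : ℕ, 0 < ∫ y in (0:ℝ)..h, φ y * Real.cosh ((i:ℝ) * (h - y)) := by
    intro i
    refine intervalIntegral.integral_pos hh
      (Continuous.continuousOn (hφc.mul (Real.continuous_cosh.comp (by fun_prop))))
      (fun y _ => mul_nonneg φ.nonneg (Real.cosh_pos _).le)
      ⟨(δ₀ + h) / 2, ⟨by linarith, by linarith⟩, mul_pos ?_ (Real.cosh_pos _)⟩
    exact φ.pos_of_mem_ball (Metric.mem_ball_self hd)
  set C : ℕ → ℝ := fun i => ∫ y in (0:ℝ)..h, φ y * Real.cosh ((i:ℝ) * (h - y)) with hCdef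
  let p : ℕ → ℝ := fun i => fp i / (Real.pi * (a i * C i))
  let q : ℕ → ℝ := fun i => fm i / (Real.pi * (a i * C i))
  have key : ∀ (i : ℕ) (g : ℝ → ℝ), (∫ x in (0:ℝ)..(2 * Real.pi), ∫ y in (0:ℝ)..h,
      (φ y * hscT N p q x) * (a i * Real.cosh ((i : ℝ) * (h - y)) * g x)) =
      (∫ x in (0:ℝ)..(2 * Real.pi), hscT N p q x * g x) * (a i * C i) := by
    intro i g
    rw [← intervalIntegral.integral_mul_const]
    congr 1
    funext x
    have : ∀ y, (φ y * hscT N p q x) * (a i * Real.cosh ((i : ℝ) * (h - y)) * g x) =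
      (hscT N p q x * g x * a i) * (φ y * Real.cosh ((i : ℝ) * (h - y))) := fun y => by ring
    simp_rw [this]
    rw [intervalIntegral.integral_const_mul, mul_assoc (hscT N p q x * g x)]
  refine ⟨fun x y => φ y * hscT N p q x, ?_, ?_, ?_, ?_, ?_, ?_⟩
  · have h1 : ContDiff ℝ (⊤ : ℕ∞) (fun z : ℝ × ℝ => φ z.2) := φ.contDiff.comp contDiff_snd
    have h2 : ContDiff ℝ (⊤ : ℕ∞) (fun z : ℝ × ℝ => hscT N p q z.1) := by
      unfold hscT
      fun_prop
    exact h1.mul h2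
  · intro x y
    have : hscT N p q (x + 2 * Real.pi) = hscT N p q x := by
      unfold hscT
      refine Finset.sum_congr rfl fun j _ => ?_
      rw [mul_add, Real.cos_add_nat_mul_two_pi, Real.sin_add_nat_mul_two_pi]
    simp only [this]
  · intro x y hy
    rw [← hφs, Function.notMem_support] at hy
    simp [hy]
  · simp_rw [intervalIntegral.integral_mul_const]
    rw [intervalIntegral.integral_const_mul, hscT_one, mul_zero]
  · intro i hi hiN
    have h1 := ha i hi hiN
    have h2 := (hC i).ne'
    have h3 := Real.pi_ne_zero
    refine (key i (fun x => Real.cos ((i:ℝ) * x))).trans ?_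
    rw [hscT_cos N p q i hi hiN]
    change fp i / (Real.pi * (a i * C i)) * Real.pi * (a i * C i) = fp i
    have h4 : C i ≠ 0 := h2
    field_simp
  · intro i hi hiN
    have h1 := ha i hi hiN
    have h2 := (hC i).ne'
    have h3 := Real.pi_ne_zero
    refine (key i (fun x => Real.sin ((i:ℝ) * x))).trans ?_
    rw [hscT_sin N p q i hi hiN]
    change fm i / (Real.pi * (a i * C i)) * Real.pi * (a i * C i) = fm i
    have h4 : C i ≠ 0 := h2
    field_simp
end

section
/- Let k > 0 and h > 0 be real numbers with k·h ≥ 1. Then for every y ∈ [0, h], one has k·y·cosh(k(h−y))/sinh(k·h) ≤ 1. -/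
/-- Uniform pointwise bound from Appendix 1 of the paper:
`k·y·cosh(k(h−y))/sinh(kh) ≤ 1` on `[0,h]` when `kh ≥ 1`. -/
theorem stream_gradient_bound (k h : ℝ) (hk : 0 < k) (hh : 0 < h)
    (hkh : 1 ≤ k * h) :
    ∀ y ∈ Set.Icc (0:ℝ) h,
      k * y * Real.cosh (k * (h - y)) / Real.sinh (k * h) ≤ 1 := by
  rintro y ⟨hy0, hyh⟩
  have hs : 0 < Real.sinh (k * h) := Real.sinh_pos_iff.2 (by positivity)
  rw [div_le_one hs]
  have e : k * h = k * y + k * (h - y) := by ring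
  rw [e, Real.sinh_add]
  have h1 : k * y ≤ Real.sinh (k * y) := Real.self_le_sinh_iff.2 (by positivity)
  have h2 : 0 ≤ Real.sinh (k * (h - y)) :=
    Real.sinh_nonneg_iff.2 (mul_nonneg hk.le (sub_nonneg.2 hyh))
  have h3 := mul_le_mul_of_nonneg_right h1 (Real.cosh_pos (k * (h - y))).le
  have h4 := mul_nonneg (Real.cosh_pos (k * y)).le h2
  linarith
end
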